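/- Let Θ be the category of finite sets with injections (objects the sets n = {1,…,n}), 𝒜 an abelian category, A an object of 𝒜, and d ≥ 1 an integer. Then there is a natural isomorphism δ_1(A[Θ(d, −)]) ≅ A[Θ(d−1, −)]^{⊕ d}, where δ_1 is the cokernel of the canonical natural transformation F → F(1 ⊔ −). Consequently A[Θ(d, −)] is strongly polynomial of degree at most d. -/

import Mathlib

open CategoryTheory CategoryTheory.Limits
universe v u

/-- The category `Θ` of finite sets with injections, with skeletal objects `ℕ`
(the object `n` standing for `{1,…,n}`) and morphisms the injections. -/
def Theta : Type := ℕ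

/-- The object of `Θ` corresponding to a natural number. -/
def Theta.mk (n : ℕ) : Theta := n

/-- The cardinality of an object of `Θ`. -/
def Theta.card (n : Theta) : ℕ := n

instance : Category.{0} Theta where
  Hom m n := Fin m.card ↪ Fin n.card
  id _ := Function.Embedding.refl _
  comp f g := f.trans g

/-- The endofunctor `x ⊔ −` of `Θ` (disjoint union with a fixed finite set `x` on the
left). -/
def sh (x : ℕ) : Theta ⥤ Theta where
  obj n := Theta.mk (x + n.card)
  map {m n} f :=
    (finSumFinEquiv.symm.toEmbedding.trans
      ((Function.Embedding.refl (Fin x)).sumMap f)).trans finSumFinEquiv.toEmbedding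
  map_id := by
    intro n
    apply Function.Embedding.ext
    intro i
    show finSumFinEquiv (Sum.map _ _ (finSumFinEquiv.symm i)) = i
    conv_rhs => rw [← Equiv.apply_symm_apply finSumFinEquiv i]
    congr 1
    generalize finSumFinEquiv.symm i = s
    rcases s with j | j <;> rfl
  map_comp := by
    intro a b c f g
    apply Function.Embedding.ext
    intro i
    show finSumFinEquiv (Sum.map _ _ (finSumFinEquiv.symm i)) =
      finSumFinEquiv (Sum.map _ _
        (finSumFinEquiv.symm (finSumFinEquiv (Sum.map _ _ (finSumFinEquiv.symm i)))))
    rw [Equiv.symm_apply_apply]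
    congr 1
    generalize finSumFinEquiv.symm i = s
    rcases s with j | j <;> rfl

/-- A morphism of `Θ` seen as an embedding. -/
def homEmb {m n : Theta} (f : m ⟶ n) : Fin m.card ↪ Fin n.card := f

/-- The canonical injection `n → x ⊔ n` in `Θ`, induced by the unique map from the empty
set (initial object) to `x`. -/
def canIncl (x : ℕ) (n : Theta) : n ⟶ (sh x).obj n :=
  (Fin.natAddOrderEmb x).toEmbedding

lemma canIncl_natural (x : ℕ) {m n : Theta} (f : m ⟶ n) :
    canIncl x m ≫ (sh x).map f = f ≫ canIncl x n := by
  apply Function.Embedding.ext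
  intro i
  show finSumFinEquiv (Sum.map _ _ (finSumFinEquiv.symm (Fin.natAdd x i))) =
    Fin.natAdd x (homEmb f i)
  rw [finSumFinEquiv_symm_apply_natAdd]
  rfl

variable {𝒜 : Type u} [Category.{v} 𝒜]

/-- The natural transformation `i_x : F ⟶ τ_x F = F(x ⊔ −)` induced by the canonical
inclusions `n → x ⊔ n`. -/
def iNat (x : ℕ) (F : Theta ⥤ 𝒜) : F ⟶ sh x ⋙ F where
  app n := F.map (canIncl x n)
  naturality := by
    intro m n f
    dsimp
    rw [← F.map_comp, ← F.map_comp, canIncl_natural]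

/-- `δ_x F`, the cokernel of `i_x : F ⟶ τ_x F`. -/
noncomputable def del [Abelian 𝒜] (x : ℕ) (F : Theta ⥤ 𝒜) : Theta ⥤ 𝒜 :=
  cokernel (iNat x F)

/-- `F : Θ ⥤ 𝒜` is strongly polynomial of degree at most `d` if every `(d+1)`-fold
iterated `δ` of `F` vanishes. -/
noncomputable def StronglyPolynomialLE [Abelian 𝒜] (d : ℕ) (F : Theta ⥤ 𝒜) : Prop :=
  ∀ l : List ℕ, l.length = d + 1 → IsZero (l.foldr del F)

instance (m n : Theta) : Finite (m ⟶ n) :=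
  inferInstanceAs (Finite (Fin m.card ↪ Fin n.card))

/-- The functor `A[Θ(t,−)]`. -/
noncomputable def rep [Abelian 𝒜] (t : ℕ) (A : 𝒜) : Theta ⥤ 𝒜 where
  obj c := ∐ fun (_ : Theta.mk t ⟶ c) => A
  map {c d} f := Sigma.desc fun g => Sigma.ι (fun (_ : Theta.mk t ⟶ d) => A) (g ≫ f)

attribute [local instance] CategoryTheory.Abelian.hasFiniteBiproducts

section Linearization

variable [Abelian 𝒜] (A : 𝒜)

/-- The functor `A[E]` sending `n` to the coproduct of copies of `A` indexed by `E n`. -/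
noncomputable def lin (E : Theta ⥤ Type) [∀ n, Finite (E.obj n)] : Theta ⥤ 𝒜 where
  obj n := ∐ fun _ : E.obj n => A
  map {m n} f := Sigma.desc fun e => Sigma.ι (fun _ : E.obj n => A) (E.map f e)

/-- The inclusion of the copy of `A` indexed by `e` in `A[E]`. -/
noncomputable def linι (E : Theta ⥤ Type) [∀ n, Finite (E.obj n)] {n : Theta} (e : E.obj n) :
    A ⟶ (lin A E).obj n :=
  Sigma.ι (fun _ : E.obj n => A) e

section

variable {A} {E : Theta ⥤ Type} [∀ n, Finite (E.obj n)]

lemma lin_hom_ext {n : Theta} {X : 𝒜} {f g : (lin A E).obj n ⟶ X}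
    (h : ∀ e, linι A E e ≫ f = linι A E e ≫ g) : f = g :=
  Sigma.hom_ext _ _ h

lemma linι_map {m n : Theta} (f : m ⟶ n) (e : E.obj m) :
    linι A E e ≫ (lin A E).map f = linι A E (E.map f e) :=
  Sigma.ι_desc _ _

/-- The morphism out of `A[E](n)` determined by a family of maps. -/
noncomputable def linDescApp {n : Theta} {X : 𝒜} (p : E.obj n → (A ⟶ X)) :
    (lin A E).obj n ⟶ X :=
  Sigma.desc p

lemma linι_linDescApp {n : Theta} {X : 𝒜} (p : E.obj n → (A ⟶ X)) (e : E.obj n) :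
    linι A E e ≫ linDescApp p = p e :=
  Sigma.ι_desc _ _

/-- The natural transformation out of `A[E]` determined by a natural family of maps. -/
noncomputable def linDesc {F : Theta ⥤ 𝒜} (p : ∀ n : Theta, E.obj n → (A ⟶ F.obj n))
    (hp : ∀ (m n : Theta) (f : m ⟶ n) (e : E.obj m), p n (E.map f e) = p m e ≫ F.map f) :
    lin A E ⟶ F where
  app n := linDescApp (p n)
  naturality m n f := lin_hom_ext fun e => by
    rw [← Category.assoc, linι_map, linι_linDescApp, ← Category.assoc, linι_linDescApp, hp]

lemma linι_linDesc {F : Theta ⥤ 𝒜} (p : ∀ n : Theta, E.obj n → (A ⟶ F.obj n))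
    (hp : ∀ (m n : Theta) (f : m ⟶ n) (e : E.obj m), p n (E.map f e) = p m e ≫ F.map f)
    {n : Theta} (e : E.obj n) : linι A E e ≫ (linDesc p hp).app n = p n e :=
  linι_linDescApp (p n) e

lemma lin_nat_ext {F : Theta ⥤ 𝒜} {α β : lin A E ⟶ F}
    (h : ∀ (n : Theta) (e : E.obj n), linι A E e ≫ α.app n = linι A E e ≫ β.app n) : α = β :=
  NatTrans.ext (funext fun n => lin_hom_ext (h n))

lemma lin_isZero (h : ∀ n, IsEmpty (E.obj n)) : IsZero (lin A E) :=
  Functor.isZero _ fun n => (IsZero.iff_id_eq_zero _).2 (lin_hom_ext fun e => (h n).elim e)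

/-- `A[-]` turns a decomposition of `E` as a disjoint union into a direct sum decomposition. -/
lemma nonempty_lin_iso_biproduct {d : ℕ} (E' : Fin d → (Theta ⥤ Type))
    [∀ i n, Finite ((E' i).obj n)] (φ : ∀ i, E' i ⟶ E)
    (hφ : ∀ n, Function.Bijective fun p : Σ i, (E' i).obj n => (φ p.1).app n p.2) :
    Nonempty (lin A E ≅ ⨁ fun i => lin A (E' i)) := by
  let q (n : Theta) : (Σ i, (E' i).obj n) ≃ E.obj n := Equiv.ofBijective _ (hφ n)
  have hq {n : Theta} (i : Fin d) (e : (E' i).obj n) : (q n).symm ((φ i).app n e) = ⟨i, e⟩ :=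
    (q n).symm_apply_apply ⟨i, e⟩
  have hq' {n : Theta} (e : E.obj n) :
      (φ ((q n).symm e).1).app n ((q n).symm e).2 = e :=
    (q n).apply_symm_apply e
  have ind {n : Theta} {P : E.obj n → Prop} (h : ∀ i e, P ((φ i).app n e)) (e : E.obj n) :
      P e := hq' e ▸ h _ _
  refine ⟨⟨linDesc (fun n e => linι A _ ((q n).symm e).2 ≫
      (biproduct.ι (fun i => lin A (E' i)) _).app n) ?_,
    biproduct.desc fun i => linDesc (fun n e => linι A E ((φ i).app n e)) ?_, ?_, ?_⟩⟩
  · intro m n f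
    refine ind fun i e => ?_
    rw [← NatTrans.naturality_apply, hq, hq]
    rw [Category.assoc, ← NatTrans.naturality, ← Category.assoc, linι_map]
  · intro m n f e
    simp [NatTrans.naturality_apply, linι_map]
  · refine lin_nat_ext fun n => ind fun i e => ?_
    rw [NatTrans.comp_app, ← Category.assoc, linι_linDesc, hq, Category.assoc,
      ← NatTrans.comp_app, biproduct.ι_desc, linι_linDesc, NatTrans.id_app, Category.comp_id]
  · refine biproduct.hom_ext' _ _ fun i => lin_nat_ext fun n e => ?_
    rw [biproduct.ι_desc_assoc, NatTrans.comp_app, ← Category.assoc, linι_linDesc, linι_linDesc,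
      hq, Category.comp_id]

end

end Linearization

section Support

/-- A notion of support for the elements of a set-valued functor on `Θ`, such that an element
comes from a subset as soon as its support lies in that subset. -/
structure Support (E : Theta ⥤ Type) where
  /-- The support of an element. -/
  supp {n : Theta} : E.obj n → Set (Fin n.card)
  supp_map {m n : Theta} (f : m ⟶ n) (e : E.obj m) : supp (E.map f e) = homEmb f '' supp e
  exists_map_eq {m n : Theta} (f : m ⟶ n) (e : E.obj n) :
    supp e ⊆ Set.range (homEmb f) → ∃ a, E.map f a = e

/-- A point of `x`, seen as a point of `x ⊔ n`. -/
def newPoint {x : ℕ} (n : Theta) (i : Fin x) : Fin ((sh x).obj n).card :=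
  Fin.castAdd n.card i

lemma homEmb_comp {l m n : Theta} (f : l ⟶ m) (g : m ⟶ n) (i : Fin l.card) :
    homEmb (f ≫ g) i = homEmb g (homEmb f i) := rfl

lemma homEmb_sh_map_canIncl (x : ℕ) {m n : Theta} (f : m ⟶ n) (i : Fin m.card) :
    homEmb ((sh x).map f) (homEmb (canIncl x m) i) = homEmb (canIncl x n) (homEmb f i) := by
  rw [← homEmb_comp, canIncl_natural, homEmb_comp]

lemma homEmb_sh_map_newPoint (x : ℕ) {m n : Theta} (f : m ⟶ n) (i : Fin x) :
    homEmb ((sh x).map f) (newPoint m i) = newPoint n i := by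
  change finSumFinEquiv (Sum.map _ _ (finSumFinEquiv.symm (Fin.castAdd m.card i))) = _
  rw [finSumFinEquiv_symm_apply_castAdd]
  rfl

lemma newPoint_ne_canIncl (x : ℕ) {n : Theta} (i : Fin x) (j : Fin n.card) :
    newPoint n i ≠ homEmb (canIncl x n) j := by
  intro h
  have h' : (i : ℕ) = x + j := congrArg Fin.val h
  lia

lemma sh_obj_cases (x : ℕ) {n : Theta} {P : Fin ((sh x).obj n).card → Prop}
    (left : ∀ i : Fin x, P (newPoint n i))
    (right : ∀ i : Fin n.card, P (homEmb (canIncl x n) i)) (i) : P i :=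
  Fin.addCases (motive := P) left right i

/-- The square formed by `f`, `x ⊔ f` and the canonical inclusions is a pullback of sets. -/
lemma exists_of_homEmb_sh_map_eq (x : ℕ) {m n : Theta} (f : m ⟶ n)
    (i : Fin ((sh x).obj m).card) (j : Fin n.card)
    (h : homEmb ((sh x).map f) i = homEmb (canIncl x n) j) :
    ∃ k, homEmb (canIncl x m) k = i ∧ homEmb f k = j := by
  induction i using sh_obj_cases with
  | left i =>
    rw [homEmb_sh_map_newPoint] at h
    exact (newPoint_ne_canIncl x i j h).elim
  | right k =>
    rw [homEmb_sh_map_canIncl] at h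
    exact ⟨k, rfl, (homEmb (canIncl x n)).injective h⟩

namespace Support

variable {E : Theta ⥤ Type} (S : Support E)

/-- The elements of `E (x ⊔ n)` which do not come from `E n`. -/
def compl (x : ℕ) : Subfunctor (sh x ⋙ E) where
  obj n := {e | ¬ S.supp (n := (sh x).obj n) e ⊆ Set.range (homEmb (canIncl x n))}
  map {m n} f e he h := he fun i hi => by
    have hmem : homEmb ((sh x).map f) i ∈ S.supp (E.map ((sh x).map f) e) := by
      rw [S.supp_map]
      exact ⟨i, hi, rfl⟩
    obtain ⟨j, hj⟩ := h hmem
    obtain ⟨k, hk, -⟩ := exists_of_homEmb_sh_map_eq x f i j hj.symm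
    exact ⟨k, hk⟩

variable {S} in
/-- Constructor for the elements of `S.compl x`. -/
def complMk {x : ℕ} {n : Theta} (e : E.obj ((sh x).obj n)) (he : e ∈ (S.compl x).obj n) :
    (S.compl x).toFunctor.obj n :=
  ⟨e, he⟩

lemma map_sh_map_mem_compl_iff (x : ℕ) {m n : Theta} (f : m ⟶ n) (e : E.obj ((sh x).obj m)) :
    E.map ((sh x).map f) e ∈ (S.compl x).obj n ↔ e ∈ (S.compl x).obj m := by
  refine ⟨fun h he => h ?_, fun h => (S.compl x).map f h⟩
  rw [S.supp_map]
  rintro _ ⟨i, hi, rfl⟩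
  obtain ⟨j, rfl⟩ := he hi
  exact ⟨_, (homEmb_sh_map_canIncl x f j).symm⟩

lemma map_canIncl_notMem_compl (x : ℕ) {n : Theta} (e : E.obj n) :
    E.map (canIncl x n) e ∉ (S.compl x).obj n := by
  intro h
  apply h
  rw [S.supp_map]
  exact Set.image_subset_range _ _

lemma exists_of_notMem_compl (x : ℕ) {n : Theta} (e : E.obj ((sh x).obj n))
    (he : e ∉ (S.compl x).obj n) : ∃ e', E.map (canIncl x n) e' = e :=
  S.exists_map_eq _ e (not_not.1 he)

/-- The support of an element of `S.compl x` is its support outside `x`. -/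
def complSupport (x : ℕ) : Support (S.compl x).toFunctor where
  supp {n} e := homEmb (canIncl x n) ⁻¹' S.supp (n := (sh x).obj n) e.1
  supp_map {m n} f e := by
    change homEmb (canIncl x n) ⁻¹' S.supp (E.map ((sh x).map f) e.1) = _
    rw [S.supp_map]
    ext j
    constructor
    · rintro ⟨i, hi, hij⟩
      obtain ⟨k, rfl, rfl⟩ := exists_of_homEmb_sh_map_eq x f i j hij
      exact ⟨k, hi, rfl⟩
    · rintro ⟨k, hk, rfl⟩
      exact ⟨_, hk, homEmb_sh_map_canIncl x f k⟩
  exists_map_eq {m n} f e he := by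
    obtain ⟨e', he'⟩ := S.exists_map_eq ((sh x).map f) e.1 (by
      intro i
      induction i using sh_obj_cases with
      | left i => exact fun _ => ⟨_, homEmb_sh_map_newPoint x f i⟩
      | right i =>
        intro hi
        obtain ⟨k, rfl⟩ := he hi
        exact ⟨_, homEmb_sh_map_canIncl x f k⟩)
    exact ⟨⟨e', (S.map_sh_map_mem_compl_iff x f e').1 (he' ▸ e.2)⟩, Subtype.ext he'⟩

lemma ncard_complSupport_supp_lt (x : ℕ) {n : Theta} (e : (S.compl x).toFunctor.obj n) :
    ((S.complSupport x).supp e).ncard < (S.supp (n := (sh x).obj n) e.1).ncard := by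
  rw [← Set.ncard_image_of_injective _ (homEmb (canIncl x n)).injective]
  refine Set.ncard_lt_ncard ⟨Set.image_preimage_subset _ _, fun h => e.2 ?_⟩
    (Set.toFinite _)
  exact h.trans (Set.image_subset_range _ _)

instance [∀ n, Finite (E.obj n)] (x : ℕ) (n : Theta) :
    Finite ((S.compl x).toFunctor.obj n) :=
  inferInstanceAs (Finite {e : E.obj ((sh x).obj n) // e ∈ (S.compl x).obj n})

section

variable [Abelian 𝒜] (A : 𝒜) [∀ n, Finite (E.obj n)] (x : ℕ)

open Classical in
/-- The projection of `A[E](x ⊔ -)` onto the summands indexed by `S.compl x`. -/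
noncomputable def proj : sh x ⋙ lin A E ⟶ lin A (S.compl x).toFunctor :=
  linDesc (E := sh x ⋙ E)
    (fun n e => if h : e ∈ (S.compl x).obj n then linι A _ (complMk e h) else 0) (by
      intro m n f e
      by_cases h : e ∈ (S.compl x).obj m
      · rw [dif_pos h, linι_map]
        exact dif_pos ((S.compl x).map f h)
      · rw [dif_neg h, zero_comp]
        exact dif_neg (mt (S.map_sh_map_mem_compl_iff x f e).1 h))

lemma linι_proj_of_mem {n : Theta} (e : E.obj ((sh x).obj n)) (he : e ∈ (S.compl x).obj n) :
    linι A E e ≫ (S.proj A x).app n = linι A _ (complMk e he) :=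
  (linι_linDescApp (E := sh x ⋙ E) _ e).trans (dif_pos he)

lemma linι_proj_of_notMem {n : Theta} (e : E.obj ((sh x).obj n))
    (he : e ∉ (S.compl x).obj n) : linι A E e ≫ (S.proj A x).app n = 0 :=
  (linι_linDescApp (E := sh x ⋙ E) _ e).trans (dif_neg he)

/-- The inclusion of the summands of `A[E](x ⊔ -)` indexed by `S.compl x`. -/
noncomputable def incl : lin A (S.compl x).toFunctor ⟶ sh x ⋙ lin A E :=
  linDesc (F := sh x ⋙ lin A E) (fun n e => linι A E (n := (sh x).obj n) e.1)
    fun _ _ f e => (linι_map ((sh x).map f) e.1).symm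

lemma linι_incl {n : Theta} (e : (S.compl x).toFunctor.obj n) :
    linι A _ e ≫ (S.incl A x).app n = linι A E (n := (sh x).obj n) e.1 :=
  linι_linDescApp _ e

lemma incl_proj : S.incl A x ≫ S.proj A x = 𝟙 _ :=
  lin_nat_ext fun n e => by
    rw [NatTrans.comp_app, ← Category.assoc, linι_incl, S.linι_proj_of_mem A x _ e.2,
      NatTrans.id_app, Category.comp_id]
    rfl

lemma iNat_proj : iNat x (lin A E) ≫ S.proj A x = 0 :=
  lin_nat_ext fun n e => by
    rw [NatTrans.comp_app, iNat, ← Category.assoc, linι_map,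
      S.linι_proj_of_notMem A x _ (S.map_canIncl_notMem_compl x e)]
    simp

lemma proj_incl_comp {F : Theta ⥤ 𝒜} (k : sh x ⋙ lin A E ⟶ F)
    (hk : iNat x (lin A E) ≫ k = 0) : S.proj A x ≫ S.incl A x ≫ k = k :=
  NatTrans.ext <| funext fun n => lin_hom_ext fun e => by
    rw [NatTrans.comp_app, NatTrans.comp_app]
    by_cases h : e ∈ (S.compl x).obj n
    · rw [← Category.assoc, S.linι_proj_of_mem A x e h, ← Category.assoc, linι_incl]
      rfl
    · rw [← Category.assoc, S.linι_proj_of_notMem A x e h, zero_comp]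
      obtain ⟨e', rfl⟩ := S.exists_of_notMem_compl x e h
      have := congrArg (linι A E e' ≫ ·) (NatTrans.congr_app hk n)
      rw [← linι_map, Category.assoc]
      simpa [iNat] using this.symm

/-- `δ_x (A[E])` is the linearization of the complement of `E` in `E (x ⊔ -)`. -/
noncomputable def delIso : del x (lin A E) ≅ lin A (S.compl x).toFunctor :=
  (cokernelIsCokernel _).coconePointUniqueUpToIso
    (CokernelCofork.IsColimit.ofπ (S.proj A x) (S.iNat_proj A x)
      (fun k _ => S.incl A x ≫ k) (fun k hk => S.proj_incl_comp A x k hk)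
      (fun k hk m hm => by rw [← hm, ← Category.assoc, incl_proj, Category.id_comp]))

end

end Support

end Support

section Representable

/-- The functor `Θ(d,-)`. -/
def homFunctor (d : ℕ) : Theta ⥤ Type := coyoneda.obj (.op (Theta.mk d))

instance (d : ℕ) (n : Theta) : Finite ((homFunctor d).obj n) :=
  inferInstanceAs (Finite (Theta.mk d ⟶ n))

/-- An injective map seen as a morphism of `Θ`. -/
def homOfInjective {d : ℕ} {n : Theta} (g : Fin d → Fin n.card) (hg : Function.Injective g) :
    Theta.mk d ⟶ n :=
  (⟨g, hg⟩ : Fin d ↪ Fin n.card)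

/-- The support of an injection is its range. -/
def homSupport (d : ℕ) : Support (homFunctor d) where
  supp e := Set.range (homEmb e)
  supp_map f e := Set.range_comp (homEmb f) (homEmb e)
  exists_map_eq {m n} f (e : Theta.mk d ⟶ n) h := by
    choose g hg using fun i => h ⟨i, rfl⟩
    refine ⟨homOfInjective g fun i j hij => (homEmb e).injective ?_,
      Function.Embedding.ext hg⟩
    exact (hg i).symm.trans ((congrArg (homEmb f) hij).trans (hg j))

lemma ncard_homSupport_supp {d : ℕ} {n : Theta} (e : (homFunctor d).obj n) :
    ((homSupport d).supp e).ncard = d := by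
  change (Set.range (homEmb e)).ncard = d
  rw [← Set.image_univ, Set.ncard_image_of_injective _ (homEmb e).injective, Set.ncard_univ]
  exact Nat.card_fin d

lemma mem_compl_homSupport_iff {d x : ℕ} {n : Theta} (e : Theta.mk d ⟶ (sh x).obj n) :
    e ∈ ((homSupport d).compl x).obj n ↔ ∃ i j, homEmb e i = newPoint n (j : Fin x) := by
  constructor
  · intro h
    by_contra! hne
    apply h
    rintro _ ⟨i, rfl⟩
    generalize hk : homEmb e i = k
    induction k using sh_obj_cases with
    | left j => exact (hne i j hk).elim
    | right j => exact ⟨j, rfl⟩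
  · rintro ⟨i, j, hij⟩ h
    obtain ⟨k, hk⟩ := h ⟨i, rfl⟩
    exact newPoint_ne_canIncl x j k (hij.symm.trans hk.symm)

/-- The map underlying `insertPoint`. -/
def insertPointFun {d : ℕ} (i : Fin (d + 1)) {n : Theta} (g : Fin d → Fin n.card) :
    Fin (d + 1) → Fin ((sh 1).obj n).card :=
  i.insertNth (α := fun _ => Fin ((sh 1).obj n).card) (newPoint n (0 : Fin 1))
    fun j => homEmb (canIncl 1 n) (g j)

lemma insertPointFun_self {d : ℕ} (i : Fin (d + 1)) {n : Theta} (g : Fin d → Fin n.card) :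
    insertPointFun i g i = newPoint n (0 : Fin 1) := by
  simp [insertPointFun]

lemma insertPointFun_succAbove {d : ℕ} (i : Fin (d + 1)) {n : Theta} (g : Fin d → Fin n.card)
    (j : Fin d) : insertPointFun i g (i.succAbove j) = homEmb (canIncl 1 n) (g j) := by
  simp [insertPointFun]

lemma insertPointFun_injective {d : ℕ} (i : Fin (d + 1)) {n : Theta} {g : Fin d → Fin n.card}
    (hg : Function.Injective g) : Function.Injective (insertPointFun i g) := by
  intro a b
  induction a using Fin.succAboveCases i <;> induction b using Fin.succAboveCases i
  · simp
  · simpa [insertPointFun_self, insertPointFun_succAbove] using newPoint_ne_canIncl 1 _ _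
  · simpa [insertPointFun_self, insertPointFun_succAbove] using (newPoint_ne_canIncl 1 _ _).symm
  · simpa [insertPointFun_succAbove] using fun h => hg h

/-- The extension of `g : d → n` to an injection `d + 1 → 1 ⊔ n` sending `i` to the new point. -/
def insertPoint {d : ℕ} (i : Fin (d + 1)) {n : Theta} (g : Theta.mk d ⟶ n) :
    Theta.mk (d + 1) ⟶ (sh 1).obj n :=
  homOfInjective (insertPointFun i (homEmb g)) (insertPointFun_injective i (homEmb g).injective)

lemma homEmb_insertPoint_self {d : ℕ} (i : Fin (d + 1)) {n : Theta} (g : Theta.mk d ⟶ n) :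
    homEmb (insertPoint i g) i = newPoint n (0 : Fin 1) :=
  insertPointFun_self i _

lemma homEmb_insertPoint_succAbove {d : ℕ} (i : Fin (d + 1)) {n : Theta} (g : Theta.mk d ⟶ n)
    (j : Fin d) :
    homEmb (insertPoint i g) (i.succAbove j) = homEmb (canIncl 1 n) (homEmb g j) :=
  insertPointFun_succAbove i _ j

lemma theta_hom_ext_succAbove {d : ℕ} (i : Fin (d + 1)) {n : Theta}
    {f g : Theta.mk (d + 1) ⟶ n} (h : homEmb f i = homEmb g i)
    (h' : ∀ j : Fin d, homEmb f (i.succAbove j) = homEmb g (i.succAbove j)) : f = g :=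
  Function.Embedding.ext (Fin.succAboveCases (α := fun k => homEmb f k = homEmb g k) i h h')

lemma insertPoint_comp {d : ℕ} (i : Fin (d + 1)) {m n : Theta} (g : Theta.mk d ⟶ m)
    (f : m ⟶ n) : insertPoint i (g ≫ f) = insertPoint i g ≫ (sh 1).map f := by
  refine theta_hom_ext_succAbove i ?_ fun j => ?_
  · exact (homEmb_insertPoint_self i _).trans ((homEmb_sh_map_newPoint 1 f 0).symm.trans
      (congrArg (homEmb ((sh 1).map f)) (homEmb_insertPoint_self i g).symm))
  · exact (homEmb_insertPoint_succAbove i _ j).trans ((homEmb_sh_map_canIncl 1 f _).symm.trans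
      (congrArg (homEmb ((sh 1).map f)) (homEmb_insertPoint_succAbove i g j).symm))

lemma insertPoint_left_inj {d : ℕ} {i i' : Fin (d + 1)} {n : Theta} {g g' : Theta.mk d ⟶ n}
    (h : insertPoint i g = insertPoint i' g') : i = i' :=
  (homEmb (insertPoint i' g')).injective (by
    rw [homEmb_insertPoint_self, ← h, homEmb_insertPoint_self])

lemma insertPoint_injective {d : ℕ} (i : Fin (d + 1)) (n : Theta) :
    Function.Injective fun g : Theta.mk d ⟶ n => insertPoint i g := by
  intro g g' h
  refine Function.Embedding.ext fun j => (homEmb (canIncl 1 n)).injective ?_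
  exact (homEmb_insertPoint_succAbove i g j).symm.trans
    ((congrArg (fun e => homEmb e (i.succAbove j)) h).trans (homEmb_insertPoint_succAbove i g' j))

lemma exists_insertPoint_eq {d : ℕ} {i : Fin (d + 1)} {n : Theta}
    {e : Theta.mk (d + 1) ⟶ (sh 1).obj n} (hi : homEmb e i = newPoint n (0 : Fin 1)) :
    ∃ g, insertPoint i g = e := by
  have hk (j : Fin d) : ∃ k, homEmb (canIncl 1 n) k = homEmb e (i.succAbove j) := by
    generalize hk : homEmb e (i.succAbove j) = k
    induction k using sh_obj_cases with
    | left z =>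
      obtain rfl := Subsingleton.elim z 0
      exact (i.succAbove_ne j ((homEmb e).injective (hk.trans hi.symm))).elim
    | right k => exact ⟨k, rfl⟩
  choose g hg using hk
  have hg' : Function.Injective g := fun a b hab => i.succAbove_right_injective
    ((homEmb e).injective (by rw [← hg, ← hg, hab]))
  refine ⟨homOfInjective g hg', theta_hom_ext_succAbove i ?_ fun j => ?_⟩
  · rw [homEmb_insertPoint_self, hi]
  · exact (homEmb_insertPoint_succAbove i _ j).trans (hg j)

/-- `insertPoint` as a natural transformation. -/
def insertPointNat {d : ℕ} (i : Fin (d + 1)) :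
    homFunctor d ⟶ ((homSupport (d + 1)).compl 1).toFunctor where
  app n := ↾fun g => ⟨insertPoint i g,
    (mem_compl_homSupport_iff _).2 ⟨i, 0, homEmb_insertPoint_self i g⟩⟩
  naturality m n f := by
    ext g
    exact Subtype.ext (insertPoint_comp i g f)

lemma insertPointNat_bijective (d : ℕ) (n : Theta) :
    Function.Bijective fun p : Σ _ : Fin (d + 1), (homFunctor d).obj n =>
      (insertPointNat p.1).app n p.2 := by
  constructor
  · rintro ⟨i, g⟩ ⟨i', g'⟩ h
    replace h : insertPoint i g = insertPoint i' g' := congrArg Subtype.val h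
    obtain rfl := insertPoint_left_inj h
    obtain rfl := insertPoint_injective i n h
    rfl
  · rintro ⟨e, he⟩
    obtain ⟨i, z, hi⟩ := (mem_compl_homSupport_iff e).1 he
    obtain rfl := Subsingleton.elim z 0
    obtain ⟨g, rfl⟩ := exists_insertPoint_eq hi
    exact ⟨⟨i, g⟩, rfl⟩

end Representable

lemma nonempty_del_iso [Abelian 𝒜] (x : ℕ) {F G : Theta ⥤ 𝒜} (α : F ≅ G) :
    Nonempty (del x F ≅ del x G) :=
  ⟨cokernel.mapIso _ _ α (Functor.isoWhiskerLeft (sh x) α) (by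
    ext n
    simp [iNat])⟩

/-- Each application of `δ` lowers the size of the supports. -/
lemma exists_foldr_del_iso [Abelian 𝒜] (A : 𝒜) {E : Theta ⥤ Type} [∀ n, Finite (E.obj n)]
    (S : Support E) {k : ℕ} (hS : ∀ n (e : E.obj n), (S.supp e).ncard ≤ k) (l : List ℕ) :
    ∃ (E' : Theta ⥤ Type) (_ : ∀ n, Finite (E'.obj n)) (S' : Support E'),
      Nonempty (l.foldr del (lin A E) ≅ lin A E') ∧
      ∀ n (e : E'.obj n), (S'.supp e).ncard + l.length ≤ k := by
  induction l with
  | nil => exact ⟨E, inferInstance, S, ⟨Iso.refl _⟩, hS⟩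
  | cons x l ih =>
    obtain ⟨E', _, S', ⟨α⟩, hS'⟩ := ih
    obtain ⟨β⟩ := nonempty_del_iso x α
    refine ⟨_, inferInstance, S'.complSupport x, ⟨β ≪≫ S'.delIso A x⟩, fun n e => ?_⟩
    have := S'.ncard_complSupport_supp_lt x e
    have := hS' _ e.1
    rw [List.length_cons]
    lia

/-- for `d ≥ 1` there is a natural isomorphism
`δ₁(A[Θ(d,−)]) ≅ A[Θ(d−1,−)]^{⊕ d}`, and consequently `A[Θ(d,−)]` is strongly polynomial
of degree at most `d`. -/
theorem del_one_rep_and_rep_stronglyPolynomial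
    {𝒜 : Type u} [Category.{v} 𝒜] [Abelian 𝒜] (d : ℕ) (hd : 1 ≤ d) (A : 𝒜) :
    Nonempty (del 1 (rep d A) ≅ ⨁ (fun _ : Fin d => rep (d - 1) A)) ∧
    StronglyPolynomialLE d (rep d A) := by
  constructor
  · obtain ⟨d, rfl⟩ := Nat.exists_eq_add_of_le' hd
    obtain ⟨α⟩ := nonempty_lin_iso_biproduct (A := A) (fun _ => homFunctor d) insertPointNat
      (insertPointNat_bijective d)
    exact ⟨(homSupport (d + 1)).delIso A 1 ≪≫ α⟩
  · intro l hl
    obtain ⟨E, _, S, ⟨α⟩, hS⟩ :=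
      exists_foldr_del_iso A (homSupport d) (fun _ e => (ncard_homSupport_supp e).le) l
    refine (lin_isZero fun n => ⟨fun e => ?_⟩).of_iso α
    have := hS n e
    lia
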